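/- Let d ∈ ℕ, T,R,q,K,𝒦 ∈ [0,∞), φ ∈ C(ℝ^d,[0,∞)), let (Ω,ℱ,ℙ) be a probability space, let ‖·‖ be a norm on ℝ^d, let X^x: [0,T]×Ω → ℝ^d, x ∈ ℝ^d, be stochastic processes with continuous sample paths which satisfy for all t ∈ [0,T], ω ∈ Ω that the map x ↦ X^x(t,ω) is in C¹(ℝ^d,ℝ^d); assume for all x ∈ ℝ^d, t ∈ [0,T], ω ∈ Ω, and all h ∈ ℝ^d such that the map [0,T] ∋ s ↦ (∂/∂x X^x(s,ω))(h) ∈ ℝ^d is ℬ([0,T])/ℬ(ℝ^d)-measurable, that ∫₀^T ‖(∂/∂x X^x(s,ω))(h)‖ ds < ∞ and ‖(∂/∂x X^x(t,ω))(h)‖ ≤ ‖h‖ + ∫₀^t φ(X^x(s,ω))·‖(∂/∂x X^x(s,ω))(h)‖ ds; assume E[sup_{x∈ℚ^d: ‖x‖≤R+1} sup_{t∈[0,T]∩ℚ} (φ(X^x(t)))^{4q+4}] ≤ K; assume for all x ∈ ℝ^d with ‖x‖ ≤ R+1 and all t ∈ [0,T] that E[‖X^x(t)‖²] ≤ K;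 and assume 𝒦 = 1 + 2^{4q+4}·(|ln(2+e^q)|^{4q+4} + T^{4q+4}·K). Then for all x ∈ ℝ^d with ‖x‖ ≤ R, all h ∈ ℝ^d with 0 < ‖h‖ < 1, and all t ∈ [0,T] it holds that E[‖X^{x+h}(t) − X^x(t)‖] ≤ 2·√((1+4K)·𝒦)·|ln(‖h‖)|^{−q}. -/

import Mathlib

open MeasureTheory ProbabilityTheory Filter
open scoped ENNReal NNReal

noncomputable section

/-- `N` is a norm on the real vector space `E`. -/
def IsNorm {E : Type*} [AddCommGroup E] [Module ℝ E] (N : E → ℝ) : Prop :=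
  (∀ x, N x = 0 ↔ x = 0) ∧ (∀ (a : ℝ) (x : E), N (a • x) = |a| * N x) ∧
    ∀ x y, N (x + y) ≤ N x + N y

/-- the rational points of the interval `[0,T]`. -/
def ratIcc (T : ℝ) : Set ℝ := Set.Icc 0 T ∩ Set.range ((↑) : ℚ → ℝ)

/-- the points of `ℚ^d` whose `N`-norm is at most `R`. -/
def ratBall (d : ℕ) (N : (Fin d → ℝ) → ℝ) (R : ℝ) : Set (Fin d → ℝ) :=
  {x | (∀ i, ∃ q : ℚ, (q : ℝ) = x i) ∧ N x ≤ R}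

namespace IsNorm

variable {d : ℕ} {N : (Fin d → ℝ) → ℝ}

lemma nonneg (hN : IsNorm N) (x : Fin d → ℝ) : 0 ≤ N x := by
  have h := hN.2.2 x ((-1 : ℝ) • x)
  rw [hN.2.1, neg_one_smul, add_neg_cancel, (hN.1 0).2 rfl] at h
  norm_num at h
  linarith

/-- A copy of `Fin d → ℝ` normed by `N`. -/
def Space {d : ℕ} {N : (Fin d → ℝ) → ℝ} (_ : IsNorm N) : Type := Fin d → ℝ

instance (hN : IsNorm N) : AddCommGroup hN.Space := inferInstanceAs (AddCommGroup (Fin d → ℝ))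

instance (hN : IsNorm N) : Module ℝ hN.Space := inferInstanceAs (Module ℝ (Fin d → ℝ))

instance (hN : IsNorm N) : Norm hN.Space := ⟨N⟩

lemma core (hN : IsNorm N) : NormedSpace.Core ℝ hN.Space where
  norm_nonneg := hN.nonneg
  norm_smul := hN.2.1
  norm_triangle := hN.2.2
  norm_eq_zero_iff := hN.1

instance (hN : IsNorm N) : NormedAddCommGroup hN.Space := NormedAddCommGroup.ofCore hN.core

instance (hN : IsNorm N) : NormedSpace ℝ hN.Space := NormedSpace.ofCore hN.core

/-- The identity from `Fin d → ℝ` to its copy normed by `N`. -/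
def toSpace (hN : IsNorm N) : (Fin d → ℝ) →L[ℝ] hN.Space :=
  LinearMap.toContinuousLinearMap
    { toFun := fun x => x, map_add' := fun _ _ => rfl, map_smul' := fun _ _ => rfl }

lemma norm_toSpace (hN : IsNorm N) (x : Fin d → ℝ) : ‖hN.toSpace x‖ = N x := rfl

lemma continuous (hN : IsNorm N) : Continuous N :=
  continuous_norm.comp hN.toSpace.continuous

/-- Mean value inequality along the segment from `x` to `x + h`. -/
lemma sub_le_of_fderiv_le (hN : IsNorm N) {f : (Fin d → ℝ) → (Fin d → ℝ)}
    (hf : Differentiable ℝ f) (x h : Fin d → ℝ) {C : ℝ}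
    (hC : ∀ r ∈ Set.Icc (0 : ℝ) 1, N (fderiv ℝ f (x + r • h) h) ≤ C) :
    N (f (x + h) - f x) ≤ C := by
  have hd : ∀ r : ℝ, HasDerivAt (fun r : ℝ => hN.toSpace (f (x + r • h)))
      (hN.toSpace (fderiv ℝ f (x + r • h) h)) r := by
    intro r
    have h1 : HasDerivAt (fun r : ℝ => x + r • h) h r := by
      simpa using ((hasDerivAt_id r).smul_const h).const_add x
    exact hN.toSpace.hasFDerivAt.comp_hasDerivAt r
      ((hf _).hasFDerivAt.comp_hasDerivAt r h1)
  have := norm_image_sub_le_of_norm_deriv_le_segment_01' (C := C)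
    (fun r _ => (hd r).hasDerivWithinAt)
    (fun r hr => hC r (Set.Ico_subset_Icc_self hr))
  simpa [← map_sub, norm_toSpace] using this

/-- Points of a ball are limits of rational points of the ball. -/
lemma mem_closure_ratBall (hN : IsNorm N) {R : ℝ} {y : Fin d → ℝ} (hy : N y < R) :
    y ∈ closure (ratBall d N R) := by
  have hdense : Dense {x : Fin d → ℝ | ∀ i, ∃ q : ℚ, (q : ℝ) = x i} := by
    have := dense_pi (Set.univ : Set (Fin d))
      (s := fun _ => Set.range ((↑) : ℚ → ℝ)) (fun _ _ => Rat.denseRange_cast)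
    convert this using 1
    ext x
    simp
  refine closure_mono ?_ (hdense.open_subset_closure_inter
    (isOpen_lt hN.continuous continuous_const) hy)
  exact fun z hz => ⟨hz.2, hz.1.le⟩

end IsNorm

lemma Icc_subset_closure_ratIcc {T : ℝ} (hT : 0 ≤ T) :
    Set.Icc 0 T ⊆ closure (ratIcc T) := by
  rcases hT.eq_or_lt with rfl | hT
  · rw [Set.Icc_self, Set.singleton_subset_iff]
    exact subset_closure ⟨by simp, 0, by simp⟩
  · rw [← closure_Ioo hT.ne]
    refine closure_minimal ?_ isClosed_closure
    exact (Rat.denseRange_cast.open_subset_closure_inter isOpen_Ioo).trans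
      (closure_mono (Set.inter_subset_inter_left _ Set.Ioo_subset_Icc_self))

lemma countable_ratIcc (T : ℝ) : (ratIcc T).Countable :=
  (Set.countable_range _).mono Set.inter_subset_right

lemma countable_ratBall (d : ℕ) (N : (Fin d → ℝ) → ℝ) (R : ℝ) :
    (ratBall d N R).Countable := by
  refine (Set.countable_range (fun (f : Fin d → ℚ) (i : Fin d) => (f i : ℝ))).mono ?_
  rintro x ⟨hx, -⟩
  choose f hf using hx
  exact ⟨f, funext hf⟩

/-- The supremum over rational points dominates the values at all points of the open ball. -/
lemma le_iSup_ratBall_ratIcc {d : ℕ} {N : (Fin d → ℝ) → ℝ} (hN : IsNorm N) {T R : ℝ} (hT : 0 ≤ T)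
    {F : (Fin d → ℝ) → ℝ → ℝ≥0∞} (hFt : ∀ x, ContinuousOn (F x) (Set.Icc 0 T))
    (hFx : ∀ t ∈ Set.Icc 0 T, Continuous fun x => F x t)
    {y : Fin d → ℝ} (hy : N y < R) {s : ℝ} (hs : s ∈ Set.Icc 0 T) :
    F y s ≤ ⨆ x ∈ ratBall d N R, ⨆ t ∈ ratIcc T, F x t := by
  refine ContinuousWithinAt.closure_le (hN.mem_closure_ratBall hy) (f := fun y => F y s)
    (hFx s hs).continuousWithinAt continuousWithinAt_const fun z hz => ?_
  refine ContinuousWithinAt.closure_le (Icc_subset_closure_ratIcc hT hs)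
    ((hFt z s hs).mono Set.inter_subset_left) continuousWithinAt_const fun r hr => ?_
  exact le_iSup₂_of_le z hz (le_iSup₂_of_le (f := fun t _ => F z t) r hr le_rfl)

/-- Grönwall's inequality in integral form for an integrable function. -/
lemma le_mul_exp_of_le_add_integral {T a M : ℝ} (hM : 0 ≤ M) {u : ℝ → ℝ}
    (hu : IntegrableOn u (Set.Icc 0 T))
    (h : ∀ t ∈ Set.Icc 0 T, u t ≤ a + M * ∫ s in (0 : ℝ)..t, u s)
    {t : ℝ} (ht : t ∈ Set.Icc 0 T) : u t ≤ a * Real.exp (M * t) := by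
  set U : ℝ → ℝ := (Set.Icc 0 T).indicator u with hUdef
  have hU : Integrable U := hu.integrable_indicator measurableSet_Icc
  set v : ℝ → ℝ := fun t => a + M * ∫ s in (0 : ℝ)..t, U s with hv
  have hvc : Continuous v :=
    continuous_const.add (continuous_const.mul
      (intervalIntegral.continuous_primitive (fun _ _ => hU.intervalIntegrable) 0))
  have huU : ∀ t ∈ Set.Icc 0 T, ∫ s in (0 : ℝ)..t, U s = ∫ s in (0 : ℝ)..t, u s := by
    intro t ht
    refine intervalIntegral.integral_congr fun s hs => ?_
    rw [Set.uIcc_of_le ht.1] at hs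
    have hs' : s ∈ Set.Icc 0 T := ⟨hs.1, hs.2.trans ht.2⟩
    exact Set.indicator_of_mem hs' u
  have huv : ∀ t ∈ Set.Icc 0 T, u t ≤ v t := by
    intro t ht
    simpa only [hv, huU t ht] using h t ht
  set w : ℝ → ℝ := fun t => a + M * ∫ s in (0 : ℝ)..t, v s with hw
  have hwd : ∀ t, HasDerivAt w (M * v t) t := fun t =>
    ((intervalIntegral.integral_hasDerivAt_right (hvc.intervalIntegrable _ _)
      (hvc.stronglyMeasurableAtFilter _ _) hvc.continuousAt).const_mul M).const_add a
  have hvw : ∀ t ∈ Set.Icc 0 T, v t ≤ w t := by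
    intro t ht
    have : ∫ s in (0 : ℝ)..t, U s ≤ ∫ s in (0 : ℝ)..t, v s := by
      refine intervalIntegral.integral_mono_on ht.1 hU.intervalIntegrable
        (hvc.intervalIntegrable _ _) fun s hs => ?_
      have hs' : s ∈ Set.Icc 0 T := ⟨hs.1, hs.2.trans ht.2⟩
      rw [hUdef, Set.indicator_of_mem hs']
      exact huv s hs'
    exact (add_le_add_iff_left a).2 (mul_le_mul_of_nonneg_left this hM)
  have hgd : ∀ t, HasDerivAt (fun t => Real.exp (-(M * t)) * w t)
      (Real.exp (-(M * t)) * -(M * 1) * w t + Real.exp (-(M * t)) * (M * v t)) t := fun t =>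
    (((hasDerivAt_id t).const_mul M).neg.exp).mul (hwd t)
  have hanti : AntitoneOn (fun t => Real.exp (-(M * t)) * w t) (Set.Icc 0 T) := by
    refine antitoneOn_of_deriv_nonpos (convex_Icc 0 T)
      (fun t _ => (hgd t).continuousAt.continuousWithinAt)
      (fun t _ => (hgd t).differentiableAt.differentiableWithinAt) fun t ht => ?_
    rw [(hgd t).deriv]
    have h1 := hvw t (interior_subset ht)
    have h2 : 0 ≤ Real.exp (-(M * t)) * M := by positivity
    nlinarith [mul_le_mul_of_nonneg_left h1 h2]
  have h0 := hanti ⟨le_rfl, ht.1.trans ht.2⟩ ht ht.1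
  have hw0 : w 0 = a := by simp [hw]
  simp only [mul_zero, neg_zero, Real.exp_zero, one_mul, hw0] at h0
  calc u t ≤ w t := (huv t ht).trans (hvw t ht)
    _ = Real.exp (-(M * t)) * w t * Real.exp (M * t) := by
      rw [mul_right_comm, ← Real.exp_add]; simp
    _ ≤ a * Real.exp (M * t) := by gcongr

/-- A directional derivative with respect to a parameter is measurable in `s` if the function is
continuous in `s`. -/
lemma measurable_fderiv_apply_subtype {d : ℕ} {S : Set ℝ} {Y : (Fin d → ℝ) → ℝ → (Fin d → ℝ)}
    (hc : ∀ x, ContinuousOn (Y x) S) (hd : ∀ s ∈ S, Differentiable ℝ fun x => Y x s)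
    (x h : Fin d → ℝ) :
    Measurable fun s : S => fderiv ℝ (fun y => Y y (s : ℝ)) x h := by
  refine measurable_of_tendsto_metrizable
    (f := fun (n : ℕ) (s : S) =>
      (1 / ((n : ℝ) + 1))⁻¹ • (Y (x + (1 / ((n : ℝ) + 1)) • h) s - Y x s)) (fun n => ?_) ?_
  · have hm : ∀ z, Continuous fun s : S => Y z (s : ℝ) := fun z =>
      continuousOn_iff_continuous_domRestrict.1 (hc z)
    exact (((hm _).sub (hm _)).const_smul (1 / ((n : ℝ) + 1))⁻¹).measurable
  · rw [tendsto_pi_nhds]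
    intro s
    have h1 : HasDerivAt (fun r : ℝ => x + r • h) h 0 := by
      simpa using ((hasDerivAt_id (0 : ℝ)).smul_const h).const_add x
    have h2 : HasDerivAt (fun r : ℝ => Y (x + r • h) s)
        (fderiv ℝ (fun y => Y y (s : ℝ)) x h) 0 := by
      have hf : HasFDerivAt (fun y => Y y (s : ℝ)) (fderiv ℝ (fun y => Y y (s : ℝ)) x)
          (x + (0 : ℝ) • h) := by
        simpa only [zero_smul, add_zero] using (hd s s.2 x).hasFDerivAt
      exact hf.comp_hasDerivAt (0 : ℝ) h1
    have h3 := h2.tendsto_slope_zero_right.comp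
      (tendsto_nhdsWithin_iff.2 ⟨tendsto_one_div_add_atTop_nhds_zero_nat (𝕜 := ℝ),
        Eventually.of_forall fun n => Set.mem_Ioi.2 Nat.one_div_pos_of_nat⟩)
    simpa [Function.comp_def] using h3

/-- A Lipschitz constant that is exponential in a bound on the coefficient. -/
lemma sub_le_mul_exp_of_fderiv_le {d : ℕ} {N : (Fin d → ℝ) → ℝ} (hN : IsNorm N) {T M : ℝ}
    (hM : 0 ≤ M) {φ : (Fin d → ℝ) → ℝ} (hφ0 : ∀ x, 0 ≤ φ x)
    {Y : (Fin d → ℝ) → ℝ → (Fin d → ℝ)}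
    (hc : ∀ x, ContinuousOn (Y x) (Set.Icc 0 T))
    (hd : ∀ s ∈ Set.Icc 0 T, Differentiable ℝ fun x => Y x s)
    (hder : ∀ x h : Fin d → ℝ,
      Measurable (fun s : Set.Icc (0 : ℝ) T => fderiv ℝ (fun y => Y y (s : ℝ)) x h) →
      ((∫⁻ s in Set.Icc (0 : ℝ) T, ENNReal.ofReal (N (fderiv ℝ (fun y => Y y s) x h))) < ⊤ ∧
        ∀ t ∈ Set.Icc (0 : ℝ) T, N (fderiv ℝ (fun y => Y y t) x h) ≤
          N h + ∫ s in (0 : ℝ)..t, φ (Y x s) * N (fderiv ℝ (fun y => Y y s) x h)))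
    (x h : Fin d → ℝ)
    (hφM : ∀ r ∈ Set.Icc (0 : ℝ) 1, ∀ s ∈ Set.Icc 0 T, φ (Y (x + r • h) s) ≤ M)
    {t : ℝ} (ht : t ∈ Set.Icc 0 T) :
    N (Y (x + h) t - Y x t) ≤ N h * Real.exp (M * T) := by
  refine hN.sub_le_of_fderiv_le (hd t ht) x h fun r hr => ?_
  have hmeas := measurable_fderiv_apply_subtype hc hd (x + r • h) h
  obtain ⟨hfin, hle⟩ := hder (x + r • h) h hmeas
  set u : ℝ → ℝ := fun s => N (fderiv ℝ (fun y => Y y s) (x + r • h) h) with hu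
  have hu0 : ∀ s, 0 ≤ u s := fun s => hN.nonneg _
  have hint : IntegrableOn u (Set.Icc 0 T) := by
    refine ⟨(aemeasurable_restrict_of_measurable_subtype measurableSet_Icc
      (f := u) (hN.continuous.measurable.comp hmeas)).aestronglyMeasurable, ?_⟩
    rw [hasFiniteIntegral_iff_ofReal (Eventually.of_forall hu0)]
    exact hfin
  have hgr := le_mul_exp_of_le_add_integral hM hint (a := N h) (fun t ht => ?_) ht
  · refine hgr.trans (mul_le_mul_of_nonneg_left ?_ (hN.nonneg h))
    exact Real.exp_le_exp.2 (mul_le_mul_of_nonneg_left ht.2 hM)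
  · refine (hle t ht).trans ?_
    rw [← intervalIntegral.integral_const_mul]
    gcongr
    rw [intervalIntegral.integral_of_le ht.1, intervalIntegral.integral_of_le ht.1]
    have hsub : Set.Ioc 0 t ⊆ Set.Icc 0 T := fun s hs => ⟨hs.1.le, hs.2.trans ht.2⟩
    refine integral_mono_of_nonneg (Eventually.of_forall fun s => mul_nonneg (hφ0 _) (hu0 s))
      ((hint.mono_set hsub).const_mul M) ?_
    filter_upwards [ae_restrict_mem measurableSet_Ioc] with s hs
    exact mul_le_mul_of_nonneg_right (hφM r hr s (hsub hs)) (hu0 s)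

lemma rpow_mul_exp_neg_half_le {q L : ℝ} (hq : 0 ≤ q) (hL : 0 < L) :
    L ^ q * Real.exp (-(L / 2)) ≤ (2 * Real.log (2 + Real.exp q)) ^ (2 * q + 2) := by
  set ℓ := Real.log (2 + Real.exp q) with hℓ
  have hlq : q ≤ ℓ := by
    rw [hℓ, Real.le_log_iff_exp_le (by positivity)]; linarith
  have hl1 : 1 ≤ ℓ := by
    rw [hℓ, Real.le_log_iff_exp_le (by positivity)]
    have := Real.exp_one_lt_three
    have := Real.one_le_exp hq
    linarith
  rcases hq.eq_or_lt with rfl | hq'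
  · rw [Real.rpow_zero, one_mul]
    exact (Real.exp_le_one_iff.2 (by linarith)).trans
      (Real.one_le_rpow (by linarith) (by norm_num))
  · have h1 : L ≤ 2 * q * Real.exp (L / (2 * q)) := by
      have := Real.add_one_le_exp (L / (2 * q))
      have h2 : L = 2 * q * (L / (2 * q)) := by field_simp
      nlinarith
    calc L ^ q * Real.exp (-(L / 2))
        ≤ (2 * q * Real.exp (L / (2 * q))) ^ q * Real.exp (-(L / 2)) := by gcongr
      _ = (2 * q) ^ q := by
        rw [Real.mul_rpow (by positivity) (by positivity), ← Real.exp_mul, mul_assoc,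
          ← Real.exp_add]
        have : L / (2 * q) * q + -(L / 2) = 0 := by field_simp; ring
        rw [this, Real.exp_zero, mul_one]
      _ ≤ (2 * ℓ) ^ q := by gcongr
      _ ≤ (2 * ℓ) ^ (2 * q + 2) :=
        Real.rpow_le_rpow_of_exponent_le (by linarith) (by linarith)

/-- The deterministic estimate behind the moment bound. -/
lemma le_log_rpow_mul {q T M S A B ℓ D η : ℝ} (hq : 0 ≤ q) (hT : 0 ≤ T) (hM : 0 ≤ M)
    (hS : M ^ (4 * q + 4) = S) (hA : 1 ≤ A) (hB : 0 < B)
    (hℓ : ℓ = Real.log (2 + Real.exp q)) (hB' : (2 * ℓ) ^ (4 * q + 4) ≤ B)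
    (hD : 0 ≤ D) (hη : 0 < η) (hη1 : η < 1) (hle : D ≤ η * Real.exp (M * T)) :
    D ≤ √(A * B) * |Real.log η| ^ (-q) *
      (1 + (D ^ 2 / A + (1 + 2 ^ (4 * q + 4) * T ^ (4 * q + 4) * S) / B) / 2) := by
  have hlog : Real.log η < 0 := Real.log_neg hη hη1
  set L := |Real.log η| with hLdef
  have hL : 0 < L := abs_pos.2 hlog.ne
  have hηL : η = Real.exp (-L) := by
    rw [hLdef, abs_of_neg hlog, neg_neg, Real.exp_log hη]
  have hℓ0 : 0 ≤ ℓ := by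
    rw [hℓ]; exact Real.log_nonneg (by linarith [Real.exp_pos q])
  have hA0 : 0 < A := by linarith
  have hLq : 0 < L ^ q := by positivity
  set Z := (2 * (T * M)) ^ q with hZ
  have hZ0 : 0 ≤ Z := by positivity
  have hZ2 : Z ^ 2 ≤ 1 + 2 ^ (4 * q + 4) * T ^ (4 * q + 4) * S := by
    rw [← hS, ← Real.mul_rpow (by norm_num) hT, ← Real.mul_rpow (by positivity) hM, mul_assoc,
      hZ, ← Real.rpow_natCast, ← Real.rpow_mul (by positivity)]
    push_cast
    rcases le_total (2 * (T * M)) 1 with h | h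
    · have := Real.rpow_le_one (by positivity) h (show 0 ≤ q * 2 by positivity)
      have h' : 0 ≤ (2 * (T * M)) ^ (4 * q + 4) := by positivity
      linarith
    · have := Real.rpow_le_rpow_of_exponent_le h (show q * 2 ≤ 4 * q + 4 by linarith)
      linarith
  have hexp : L ^ q * Real.exp (-(L / 2)) ≤ √(A * B) := by
    refine (rpow_mul_exp_neg_half_le hq hL).trans (Real.le_sqrt_of_sq_le ?_)
    rw [← hℓ, ← Real.rpow_natCast, ← Real.rpow_mul (by positivity)]
    have h4 : (2 * q + 2) * ((2 : ℕ) : ℝ) = 4 * q + 4 := by push_cast; ring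
    rw [h4]
    nlinarith
  have hsplit : D * L ^ q ≤ √(A * B) + D * Z := by
    rcases le_total (2 * (T * M)) L with h | h
    · have h1 : D ≤ Real.exp (-(L / 2)) := by
        refine hle.trans ?_
        rw [hηL, ← Real.exp_add, Real.exp_le_exp]
        linarith
      have h2 : D * L ^ q ≤ L ^ q * Real.exp (-(L / 2)) := by
        rw [mul_comm]; gcongr
      have h3 : 0 ≤ D * Z := by positivity
      linarith
    · have h1 : L ^ q ≤ Z := Real.rpow_le_rpow hL.le h hq
      have h2 := mul_le_mul_of_nonneg_left h1 hD
      have h3 := Real.sqrt_nonneg (A * B)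
      linarith
  have hyoung : D * Z ≤ √(A * B) * ((D ^ 2 / A + Z ^ 2 / B) / 2) := by
    have hsA : √A ^ 2 = A := Real.sq_sqrt hA0.le
    have hsB : √B ^ 2 = B := Real.sq_sqrt hB.le
    have hpA : 0 < √A := Real.sqrt_pos.2 hA0
    have hpB : 0 < √B := Real.sqrt_pos.2 hB
    have h1 := two_mul_le_add_sq (D / √A) (Z / √B)
    rw [div_pow, div_pow, hsA, hsB] at h1
    have h2 : D * Z = √(A * B) * (2 * (D / √A) * (Z / √B) / 2) := by
      rw [Real.sqrt_mul hA0.le]; field_simp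
    rw [h2]
    gcongr
  have hfin : D * L ^ q ≤ √(A * B) *
      (1 + (D ^ 2 / A + (1 + 2 ^ (4 * q + 4) * T ^ (4 * q + 4) * S) / B) / 2) := by
    have : √(A * B) * ((D ^ 2 / A + Z ^ 2 / B) / 2) ≤ √(A * B) *
      ((D ^ 2 / A + (1 + 2 ^ (4 * q + 4) * T ^ (4 * q + 4) * S) / B) / 2) := by gcongr
    linarith
  rw [Real.rpow_neg hL.le, mul_right_comm, ← div_eq_mul_inv, le_div_iff₀ hLq]
  exact hfin

/-- **Lemma (quantitative conditional regularity estimate).** -/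
theorem conditional_log_hoelder_quantitative
    (d : ℕ) (hd : 0 < d) (T R q K KK : ℝ)
    (hT : 0 ≤ T) (hR : 0 ≤ R) (hq : 0 ≤ q) (hK : 0 ≤ K) (hKK0 : 0 ≤ KK)
    (φ : (Fin d → ℝ) → ℝ) (hφc : Continuous φ) (hφ0 : ∀ x, 0 ≤ φ x)
    {Ω : Type*} [MeasurableSpace Ω] (P : Measure Ω) [IsProbabilityMeasure P]
    (Nd : (Fin d → ℝ) → ℝ) (hNd : IsNorm Nd)
    (X : (Fin d → ℝ) → ℝ → Ω → (Fin d → ℝ))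
    (hXmeas : ∀ x : Fin d → ℝ, ∀ t ∈ Set.Icc (0 : ℝ) T,
      Measurable (fun ω => X x t ω))
    (hXcont : ∀ (x : Fin d → ℝ) (ω : Ω),
      ContinuousOn (fun t => X x t ω) (Set.Icc (0 : ℝ) T))
    (hXC1 : ∀ t ∈ Set.Icc (0 : ℝ) T, ∀ ω, ContDiff ℝ 1 (fun x => X x t ω))
    (hder : ∀ (x : Fin d → ℝ) (ω : Ω) (h : Fin d → ℝ),
      Measurable (fun s : Set.Icc (0 : ℝ) T =>
        fderiv ℝ (fun y => X y (s : ℝ) ω) x h) →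
      ((∫⁻ s in Set.Icc (0 : ℝ) T,
          ENNReal.ofReal (Nd (fderiv ℝ (fun y => X y s ω) x h))) < ⊤ ∧
        ∀ t ∈ Set.Icc (0 : ℝ) T,
          Nd (fderiv ℝ (fun y => X y t ω) x h) ≤
            Nd h + ∫ s in (0 : ℝ)..t,
              φ (X x s ω) * Nd (fderiv ℝ (fun y => X y s ω) x h)))
    (hmomφ : (∫⁻ ω, (⨆ x ∈ ratBall d Nd (R + 1), ⨆ t ∈ ratIcc T,
      ENNReal.ofReal (φ (X x t ω) ^ (4 * q + 4))) ∂P) ≤ ENNReal.ofReal K)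
    (hmom2 : ∀ x : Fin d → ℝ, Nd x ≤ R + 1 → ∀ t ∈ Set.Icc (0 : ℝ) T,
      (∫⁻ ω, ENNReal.ofReal (Nd (X x t ω) ^ 2) ∂P) ≤ ENNReal.ofReal K)
    (hKK : KK = 1 + (2 : ℝ) ^ (4 * q + 4) *
      (|Real.log (2 + Real.exp q)| ^ (4 * q + 4) + T ^ (4 * q + 4) * K)) :
    ∀ x : Fin d → ℝ, Nd x ≤ R → ∀ h : Fin d → ℝ, 0 < Nd h → Nd h < 1 →
      ∀ t ∈ Set.Icc (0 : ℝ) T,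
        (∫⁻ ω, ENNReal.ofReal (Nd (X (x + h) t ω - X x t ω)) ∂P) ≤
          ENNReal.ofReal (2 * Real.sqrt ((1 + 4 * K) * KK) *
            |Real.log (Nd h)| ^ (-q)) := by
  intro x hx h hh0 hh1 t ht
  set ℓ := Real.log (2 + Real.exp q) with hℓ
  have hℓ0 : 0 ≤ ℓ := Real.log_nonneg (by linarith [Real.exp_pos q])
  rw [abs_of_nonneg hℓ0] at hKK
  have hp : 0 < 4 * q + 4 := by linarith
  set p := 4 * q + 4 with hpdef
  set c : ℝ := 2 ^ p * T ^ p with hc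
  have hc0 : 0 ≤ c := by positivity
  have hKK' : KK = 1 + (2 * ℓ) ^ p + c * K := by
    rw [hKK, hc, Real.mul_rpow (by norm_num) hℓ0]; ring
  have hℓp : 0 ≤ (2 * ℓ) ^ p := by positivity
  have hcK : 0 ≤ c * K := by positivity
  have hB : 0 < KK := by linarith
  set A := 1 + 4 * K with hA
  have hA1 : 1 ≤ A := by linarith
  have hA0 : 0 < A := by linarith
  set C := √(A * KK) * |Real.log (Nd h)| ^ (-q) with hC
  have hC0 : 0 ≤ C := by positivity
  have hxh : Nd (x + h) ≤ R + 1 := (hNd.2.2 x h).trans (by linarith)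
  set S : Ω → ℝ≥0∞ := fun ω => ⨆ x ∈ ratBall d Nd (R + 1), ⨆ t ∈ ratIcc T,
    ENNReal.ofReal (φ (X x t ω) ^ p) with hS
  have hSm : Measurable S :=
    Measurable.biSup _ (countable_ratBall d Nd (R + 1)) fun y _ =>
      Measurable.biSup _ (countable_ratIcc T) fun s hs =>
        ((hφc.measurable.comp (hXmeas y s hs.1)).pow_const p).ennreal_ofReal
  have hSfin : ∀ᵐ ω ∂P, S ω < ⊤ :=
    ae_lt_top hSm (hmomφ.trans_lt ENNReal.ofReal_lt_top).ne
  have hφp : Continuous fun y => ENNReal.ofReal (φ y ^ p) :=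
    ENNReal.continuous_ofReal.comp (hφc.rpow_const fun _ => Or.inr hp.le)
  have hbound : ∀ᵐ ω ∂P, ENNReal.ofReal (Nd (X (x + h) t ω - X x t ω)) ≤
      ENNReal.ofReal (C * (1 + 1 / (2 * KK))) +
        ENNReal.ofReal (C / A) * ENNReal.ofReal (Nd (X (x + h) t ω) ^ 2) +
        ENNReal.ofReal (C / A) * ENNReal.ofReal (Nd (X x t ω) ^ 2) +
        ENNReal.ofReal (C * c / (2 * KK)) * S ω := by
    filter_upwards [hSfin] with ω hω
    set M := (S ω).toReal ^ p⁻¹ with hM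
    have hM0 : 0 ≤ M := by positivity
    have hMp : M ^ p = (S ω).toReal := Real.rpow_inv_rpow ENNReal.toReal_nonneg hp.ne'
    have hφM : ∀ r ∈ Set.Icc (0 : ℝ) 1, ∀ s ∈ Set.Icc 0 T, φ (X (x + r • h) s ω) ≤ M := by
      intro r hr s hs
      have hy : Nd (x + r • h) < R + 1 := by
        have h1 := hNd.2.2 x (r • h)
        rw [hNd.2.1, abs_of_nonneg hr.1] at h1
        nlinarith [hr.2]
      have h2 : ENNReal.ofReal (φ (X (x + r • h) s ω) ^ p) ≤ S ω :=
        le_iSup_ratBall_ratIcc hNd hT (F := fun y s => ENNReal.ofReal (φ (X y s ω) ^ p))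
          (fun y => hφp.comp_continuousOn (hXcont y ω))
          (fun s hs => hφp.comp (hXC1 s hs ω).continuous) hy hs
      rw [ENNReal.ofReal_le_iff_le_toReal hω.ne, ← hMp] at h2
      exact (Real.rpow_le_rpow_iff (hφ0 _) hM0 hp).1 h2
    have hLip := sub_le_mul_exp_of_fderiv_le hNd hM0 hφ0 (Y := fun y s => X y s ω)
      (fun y => hXcont y ω) (fun s hs => (hXC1 s hs ω).differentiable one_ne_zero)
      (fun y k => hder y ω k) x h hφM ht
    have hkey := le_log_rpow_mul hq hT hM0 hMp hA1 hB hℓ (by rw [hKK']; linarith)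
      (hNd.nonneg _) hh0 hh1 hLip
    rw [← hpdef, ← hc, ← hC] at hkey
    rw [← ENNReal.ofReal_toReal hω.ne]
    have ha0 := hNd.nonneg (X (x + h) t ω)
    have hb0 := hNd.nonneg (X x t ω)
    have hD0 := hNd.nonneg (X (x + h) t ω - X x t ω)
    have htri : Nd (X (x + h) t ω - X x t ω) ≤ Nd (X (x + h) t ω) + Nd (X x t ω) := by
      have h1 := hNd.2.2 (X (x + h) t ω) ((-1 : ℝ) • X x t ω)
      rwa [hNd.2.1, neg_one_smul, ← sub_eq_add_neg, abs_neg, abs_one, one_mul] at h1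
    have hS0 : 0 ≤ (S ω).toReal := ENNReal.toReal_nonneg
    generalize Nd (X (x + h) t ω - X x t ω) = D at *
    generalize Nd (X (x + h) t ω) = a at *
    generalize Nd (X x t ω) = b at *
    generalize (S ω).toReal = σ at *
    rw [← ENNReal.ofReal_mul (by positivity), ← ENNReal.ofReal_mul (by positivity),
      ← ENNReal.ofReal_mul (by positivity), ← ENNReal.ofReal_add (by positivity) (by positivity),
      ← ENNReal.ofReal_add (by positivity) (by positivity),
      ← ENNReal.ofReal_add (by positivity) (by positivity)]
    refine ENNReal.ofReal_le_ofReal (hkey.trans ?_)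
    have hsq : D ^ 2 ≤ 2 * (a ^ 2 + b ^ 2) := by nlinarith [sq_nonneg (a - b)]
    calc C * (1 + (D ^ 2 / A + (1 + c * σ) / KK) / 2)
        ≤ C * (1 + (2 * (a ^ 2 + b ^ 2) / A + (1 + c * σ) / KK) / 2) := by gcongr
      _ = _ := by field_simp; ring
  have hNm : ∀ y, Measurable fun ω => ENNReal.ofReal (Nd (X y t ω) ^ 2) := fun y =>
    ((hNd.continuous.measurable.comp (hXmeas y t ht)).pow_const 2).ennreal_ofReal
  refine (lintegral_mono_ae hbound).trans ?_
  rw [lintegral_add_right _ (hSm.const_mul _), lintegral_add_right _ ((hNm x).const_mul _),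
    lintegral_add_right _ ((hNm (x + h)).const_mul _), lintegral_const, measure_univ, mul_one,
    lintegral_const_mul _ hSm, lintegral_const_mul _ (hNm x), lintegral_const_mul _ (hNm (x + h))]
  calc _ ≤ ENNReal.ofReal (C * (1 + 1 / (2 * KK))) +
        ENNReal.ofReal (C / A) * ENNReal.ofReal K + ENNReal.ofReal (C / A) * ENNReal.ofReal K +
        ENNReal.ofReal (C * c / (2 * KK)) * ENNReal.ofReal K := by
        gcongr
        · exact hmom2 _ hxh t ht
        · exact hmom2 _ (by linarith) t ht
    _ = ENNReal.ofReal (C * (1 + 2 * K / A + (1 + c * K) / (2 * KK))) := by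
        rw [← ENNReal.ofReal_mul (by positivity), ← ENNReal.ofReal_mul (by positivity),
          ← ENNReal.ofReal_add (by positivity) (by positivity),
          ← ENNReal.ofReal_add (by positivity) (by positivity),
          ← ENNReal.ofReal_add (by positivity) (by positivity)]
        congr 1
        field_simp
        ring
    _ ≤ ENNReal.ofReal (2 * √(A * KK) * |Real.log (Nd h)| ^ (-q)) := by
        refine ENNReal.ofReal_le_ofReal ?_
        have h1 : 2 * K / A ≤ 1 / 2 := by
          rw [div_le_iff₀ hA0]; linarith
        have h2 : (1 + c * K) / (2 * KK) ≤ 1 / 2 := by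
          rw [div_le_iff₀ (by positivity)]; linarith
        rw [mul_assoc 2, ← hC]
        nlinarith
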